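/- Let λ ≥ 1, d ≥ 1, T ≥ 1, and x₁, …, x_T ∈ ℝ^d with ‖x_t‖₂ ≤ 1 for all t. For 0 ≤ t ≤ T define M_t = λI + ∑_{s=1}^t x_s x_sᵀ. Then ∑_{t=1}^T √(x_tᵀ M_{t−1}⁻¹ x_t) ≤ √(2dT log(1 + T/(λd))). -/

import Mathlib

open Matrix

/-- AM-GM for the eigenvalues of a positive definite matrix, in logarithmic form. -/
theorem Matrix.PosDef.log_det_le {n : Type*} [Fintype n] [DecidableEq n] {A : Matrix n n ℝ}
    (hA : A.PosDef) {c : ℝ} (hc : 0 < c) (htr : A.trace ≤ Fintype.card n * c) :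
    Real.log A.det ≤ Fintype.card n * Real.log c := by
  have hdet := hA.isHermitian.det_eq_prod_eigenvalues
  have htrace := hA.isHermitian.trace_eq_sum_eigenvalues
  simp only [RCLike.ofReal_real_eq_id, id_eq] at hdet htrace
  rw [hdet, Real.log_prod fun i _ => (hA.eigenvalues_pos i).ne']
  have hlog : ∀ i, Real.log (hA.isHermitian.eigenvalues i) ≤
      Real.log c + (hA.isHermitian.eigenvalues i / c - 1) := fun i => by
    have hi := hA.eigenvalues_pos i
    have h := Real.log_le_sub_one_of_pos (div_pos hi hc)
    rw [Real.log_div hi.ne' hc.ne'] at h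
    linarith
  refine (Finset.sum_le_sum fun i _ => hlog i).trans ?_
  rw [Finset.sum_add_distrib, Finset.sum_sub_distrib, ← Finset.sum_div, ← htrace]
  simp only [Finset.sum_const, Finset.card_univ, nsmul_eq_mul, mul_one]
  linarith [(div_le_iff₀ hc).2 htr]

theorem Matrix.det_add_vecMulVec_self {n : Type*} [Fintype n] [DecidableEq n] {A : Matrix n n ℝ}
    (hA : IsUnit A.det) (v : n → ℝ) :
    (A + vecMulVec v v).det = A.det * (1 + v ⬝ᵥ A⁻¹ *ᵥ v) := by
  rw [vecMulVec_eq Unit, det_add_replicateCol_mul_replicateRow hA, det_unique (n := Unit),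
    Matrix.mul_assoc, ← replicateCol_mulVec, add_apply, one_apply_eq,
    replicateRow_mul_replicateCol_apply]

theorem Matrix.posDef_smul_one_add {n : Type*} [Fintype n] [DecidableEq n] {S : Matrix n n ℝ}
    (hS : S.PosSemidef) {c : ℝ} (hc : 0 < c) : (c • (1 : Matrix n n ℝ) + S).PosDef :=
  (PosDef.one.smul hc).add_posSemidef hS

theorem Matrix.PosSemidef.dotProduct_inv_smul_one_add_mulVec_le_one {n : Type*} [Fintype n]
    [DecidableEq n] {S : Matrix n n ℝ} (hS : S.PosSemidef) {c : ℝ} (hc : 1 ≤ c) {v : n → ℝ}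
    (hv : v ⬝ᵥ v ≤ 1) : v ⬝ᵥ (c • (1 : Matrix n n ℝ) + S)⁻¹ *ᵥ v ≤ 1 := by
  have hA := posDef_smul_one_add hS (zero_lt_one.trans_le hc)
  set A := c • (1 : Matrix n n ℝ) + S with hAdef
  set y := A⁻¹ *ᵥ v with hy
  have hAy : A *ᵥ y = v := by
    rw [hy, mulVec_mulVec, mul_nonsing_inv _ hA.det_pos.ne'.isUnit, one_mulVec]
  have hvy : v ⬝ᵥ y = c * (y ⬝ᵥ y) + y ⬝ᵥ S *ᵥ y := by
    nth_rewrite 1 [← hAy]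
    rw [dotProduct_comm, hAdef, add_mulVec, smul_mulVec, one_mulVec, dotProduct_add,
      dotProduct_smul, smul_eq_mul]
  have hSy : 0 ≤ y ⬝ᵥ S *ᵥ y := by simpa using hS.dotProduct_mulVec_nonneg y
  have hyy : 0 ≤ y ⬝ᵥ y := by simpa using dotProduct_star_self_nonneg y
  have hsub : 0 ≤ (v - y) ⬝ᵥ (v - y) := by simpa using dotProduct_star_self_nonneg (v - y)
  rw [sub_dotProduct, dotProduct_sub, dotProduct_sub, dotProduct_comm y v] at hsub
  nlinarith

theorem Real.le_two_mul_log_one_add {u : ℝ} (h0 : 0 ≤ u) (h1 : u ≤ 1) :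
    u ≤ 2 * Real.log (1 + u) := by
  have h := Real.one_sub_inv_le_log_of_pos (x := 1 + u) (by linarith)
  have h' : u / 2 ≤ 1 - (1 + u)⁻¹ := by
    rw [show 1 - (1 + u)⁻¹ = u / (1 + u) by field_simp; ring]
    exact div_le_div_of_nonneg_left h0 (by linarith) (by linarith)
  linarith

open Matrix

/-- **Elliptical potential lemma.** For `λ ≥ 1`, vectors `x₁, …, x_T ∈ ℝ^d` of norm
at most `1` and `M_t = λI + ∑_{s=1}^t x_s x_sᵀ`,
`∑_{t=1}^T √(x_tᵀ M_{t−1}⁻¹ x_t) ≤ √(2dT log(1 + T/(λd)))`. -/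
theorem stmt17 (lam : ℝ) (hlam : 1 ≤ lam) (d T : ℕ) (hd : 1 ≤ d) (hT : 1 ≤ T)
    (x : ℕ → EuclideanSpace ℝ (Fin d)) (hx : ∀ t ∈ Finset.Icc 1 T, ‖x t‖ ≤ 1)
    (M : ℕ → Matrix (Fin d) (Fin d) ℝ)
    (hM : ∀ t, M t = lam • (1 : Matrix (Fin d) (Fin d) ℝ) +
      ∑ s ∈ Finset.Icc 1 t, Matrix.vecMulVec (x s) (x s)) :
    ∑ t ∈ Finset.Icc 1 T,
        Real.sqrt ((x t : Fin d → ℝ) ⬝ᵥ (M (t - 1))⁻¹.mulVec (x t)) ≤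
      Real.sqrt (2 * d * T * Real.log (1 + T / (lam * d))) := by
  have hlam0 : 0 < lam := by linarith
  have hd0 : (0 : ℝ) < d := by exact_mod_cast hd
  have hS : ∀ t, (∑ s ∈ Finset.Icc 1 t, vecMulVec (x s) (x s) :
      Matrix (Fin d) (Fin d) ℝ).PosSemidef := fun t =>
    posSemidef_sum _ fun s _ => by simpa using posSemidef_vecMulVec_self_star (x s : Fin d → ℝ)
  have hMpos : ∀ t, (M t).PosDef := fun t => hM t ▸ posDef_smul_one_add (hS t) hlam0
  have hxx : ∀ t ∈ Finset.Icc 1 T, (x t : Fin d → ℝ) ⬝ᵥ x t ≤ 1 := fun t ht => by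
    have h := EuclideanSpace.real_norm_sq_eq (x t)
    have hle := hx t ht
    simp only [dotProduct, ← pow_two]
    rw [← h]
    exact pow_le_one₀ (norm_nonneg _) hle
  set u : ℕ → ℝ := fun t => (x t : Fin d → ℝ) ⬝ᵥ (M (t - 1))⁻¹.mulVec (x t) with hu
  have hu0 : ∀ t, 0 ≤ u t := fun t => by
    simpa using (hMpos (t - 1)).inv.posSemidef.dotProduct_mulVec_nonneg (x t : Fin d → ℝ)
  have hu1 : ∀ t ∈ Finset.Icc 1 T, u t ≤ 1 := fun t ht => by
    simp only [hu, hM]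
    exact (hS _).dotProduct_inv_smul_one_add_mulVec_le_one hlam (hxx t ht)
  have htel : ∀ t, Real.log (M t).det =
      Real.log (M 0).det + ∑ s ∈ Finset.Icc 1 t, Real.log (1 + u s) := fun t => by
    induction t with
    | zero => simp
    | succ k ih =>
      have hstep : M (k + 1) = M k + vecMulVec (x (k + 1)) (x (k + 1)) := by
        rw [hM, hM, Finset.sum_Icc_succ_top (by omega), add_assoc]
      have hpos : (0 : ℝ) < 1 + u (k + 1) := by linarith [hu0 (k + 1)]
      have hdet : (M (k + 1)).det = (M k).det * (1 + u (k + 1)) := by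
        rw [hstep, det_add_vecMulVec_self (hMpos k).det_pos.ne'.isUnit]
        rfl
      rw [hdet, Real.log_mul (hMpos k).det_pos.ne' hpos.ne', ih,
        Finset.sum_Icc_succ_top (by omega), add_assoc]
  have hdet0 : Real.log (M 0).det = d * Real.log lam := by
    simp [hM]
  have hc : 0 < lam + T / d := by positivity
  have htrace : (M T).trace ≤ Fintype.card (Fin d) * (lam + T / d) := by
    have hsum : ∑ s ∈ Finset.Icc 1 T, (x s : Fin d → ℝ) ⬝ᵥ x s ≤ T := by
      simpa using Finset.sum_le_sum hxx
    rw [hM, trace_add, trace_smul, trace_one, trace_sum]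
    simp only [trace_vecMulVec, Fintype.card_fin, smul_eq_mul]
    rw [mul_add, mul_div_cancel₀ _ hd0.ne']
    linarith
  have hlogdet := (hMpos T).log_det_le hc htrace
  have hlog : Real.log (1 + T / (lam * d)) = Real.log (lam + T / d) - Real.log lam := by
    rw [← Real.log_div hc.ne' hlam0.ne']
    congr 1
    field_simp
  have hsumu : ∑ t ∈ Finset.Icc 1 T, u t ≤ 2 * d * Real.log (1 + T / (lam * d)) := by
    calc ∑ t ∈ Finset.Icc 1 T, u t
        ≤ ∑ t ∈ Finset.Icc 1 T, 2 * Real.log (1 + u t) :=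
          Finset.sum_le_sum fun t ht => Real.le_two_mul_log_one_add (hu0 t) (hu1 t ht)
      _ = 2 * (Real.log (M T).det - Real.log (M 0).det) := by
          rw [← Finset.mul_sum, htel T]
          ring
      _ ≤ 2 * d * Real.log (1 + T / (lam * d)) := by
          rw [hdet0, hlog]
          rw [Fintype.card_fin] at hlogdet
          linarith
  apply Real.le_sqrt_of_sq_le
  have hcs := sq_sum_le_card_mul_sum_sq (s := Finset.Icc 1 T) (f := fun t => Real.sqrt (u t))
  simp only [Real.sq_sqrt (hu0 _), Nat.card_Icc, Nat.add_sub_cancel] at hcs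
  refine hcs.trans ((mul_le_mul_of_nonneg_left hsumu (Nat.cast_nonneg T)).trans_eq ?_)
  ring
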